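/- arXiv:2302.03899 — 2 statements merged into one kernel-verified Lean document; each statement's English description precedes it below -/
import Mathlib

section
/- Suppose the collection 𝒫_A^⊆ of potential-outcome distributions obeys distributional consistency, and 𝒫_A obeys the SWIG ordered local Markov property for the complete DAG 𝒢̄ on V under its unique topological order ≺ (i.e., pa(i) = pre(i) for every i). Suppose further that the observed distribution p(V) is strictly positive (assigns positive probability to every v ∈ 𝔛_V) and obeys the ordinary ordered local Markov property with respect to a subgraph 𝒢 of 𝒢̄ (with parent sets pa_𝒢(i) ⊆ pre(i)) and ≺. Then 𝒫_A obeys the SWIG ordered local Markov property for 𝒢 under ≺. -/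
open Finset

namespace CausalPaper

variable {V : Type*} [Fintype V] [LinearOrder V]
variable {𝔛 : V → Type*} [∀ i, Fintype (𝔛 i)]

/-- Probability of the event `E` under the distribution `q` on joint assignments. -/
noncomputable def pr (q : (∀ i, 𝔛 i) → ℝ) (E : (∀ i, 𝔛 i) → Prop) : ℝ :=
  ∑ v : (∀ i, 𝔛 i), Set.indicator (setOf E) q v

/-- Conditional probability of `E` given `F` under `q`. -/
noncomputable def cpr (q : (∀ i, 𝔛 i) → ℝ) (E F : (∀ i, 𝔛 i) → Prop) : ℝ :=
  pr q (fun v => E v ∧ F v) / pr q F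

/-- `q` is a probability distribution on joint assignments. -/
def IsProb (q : (∀ i, 𝔛 i) → ℝ) : Prop :=
  (∀ v, 0 ≤ q v) ∧ (∑ v : (∀ i, 𝔛 i), q v) = 1

/-- `v` agrees with `s` on the coordinates in `S`. -/
def agree (S : Finset V) (s v : ∀ i, 𝔛 i) : Prop :=
  ∀ i ∈ S, v i = s i

/-- The intervention/regime that sets the variables in `B` according to `b`
(and is idle elsewhere). -/
def setOn (B : Finset V) (b : ∀ i, 𝔛 i) : ∀ i, Option (𝔛 i) :=
  fun i => if i ∈ B then some (b i) else none

/-- The support of the partial intervention/regime `f` is contained in `A`. -/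
def suppIn (f : ∀ i, Option (𝔛 i)) (A : Finset V) : Prop :=
  ∀ i, f i ≠ none → i ∈ A

/-- Distributional consistency. -/
def DistConsistent (A : Finset V) (P : (∀ i, Option (𝔛 i)) → (∀ i, 𝔛 i) → ℝ) : Prop :=
  ∀ i ∈ A, ∀ C : Finset V, C ⊆ A \ {i} →
    ∀ (y : ∀ j, 𝔛 j) (b : 𝔛 i) (c : ∀ j, 𝔛 j),
      pr (P (Function.update (setOn C c) i (some b)))
          (fun v => agree (univ \ {i}) y v ∧ v i = b)
        = pr (P (setOn C c)) (fun v => agree (univ \ {i}) y v ∧ v i = b)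

/-- The predecessors of `i` under the total order on `V`. -/
def pre (i : V) : Finset V := univ.filter (fun j => j < i)

/-- The (SWIG / augmented-DAG) ordered local Markov property: under the regime
intervening on all of `A`, the conditional distribution of `X_i` given its
predecessors is a function only of `a` on `pa i ∩ A` and of `w` on `pa i \ A`. -/
def SWIGLocalMarkov (A : Finset V) (pa : V → Finset V)
    (P : (∀ i, Option (𝔛 i)) → (∀ i, 𝔛 i) → ℝ) : Prop :=
  ∀ (i : V) (a a' w w' : ∀ j, 𝔛 j) (x : 𝔛 i),
    0 < pr (P (setOn A a)) (agree (pre i) w) →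
    0 < pr (P (setOn A a')) (agree (pre i) w') →
    (∀ j ∈ pa i ∩ A, a j = a' j) →
    (∀ j ∈ pa i \ A, w j = w' j) →
    cpr (P (setOn A a)) (fun v => v i = x) (agree (pre i) w)
      = cpr (P (setOn A a')) (fun v => v i = x) (agree (pre i) w')

/-- The ordinary ordered local Markov property for a single distribution `q`:
the conditional distribution of `X_i` given its predecessors is a function only
of the values of the parents. -/
def OrderedLocalMarkov (pa : V → Finset V) (q : (∀ i, 𝔛 i) → ℝ) : Prop :=
  ∀ (i : V) (w w' : ∀ j, 𝔛 j) (x : 𝔛 i),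
    0 < pr q (agree (pre i) w) →
    0 < pr q (agree (pre i) w') →
    (∀ j ∈ pa i, w j = w' j) →
    cpr q (fun v => v i = x) (agree (pre i) w)
      = cpr q (fun v => v i = x) (agree (pre i) w')

lemma pr_eq_sum_indicator (q : (∀ i, 𝔛 i) → ℝ) (E : (∀ i, 𝔛 i) → Prop) :
    pr q E = ∑ v, Set.indicator (Set.ofPred E) q v :=
  rfl

lemma pr_congr (q : (∀ i, 𝔛 i) → ℝ) {E F : (∀ i, 𝔛 i) → Prop} (h : ∀ v, E v ↔ F v) :
    pr q E = pr q F := by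
  rw [show E = F from funext fun v => propext (h v)]

lemma pr_nonneg {q : (∀ i, 𝔛 i) → ℝ} (hq : ∀ v, 0 ≤ q v) (E : (∀ i, 𝔛 i) → Prop) :
    0 ≤ pr q E :=
  sum_nonneg fun v _ => Set.indicator_nonneg (fun v _ => hq v) v

lemma pr_mono {q : (∀ i, 𝔛 i) → ℝ} (hq : ∀ v, 0 ≤ q v) {E F : (∀ i, 𝔛 i) → Prop}
    (h : ∀ v, E v → F v) : pr q E ≤ pr q F :=
  sum_le_sum fun v _ => Set.indicator_le_indicator_of_subset (s := Set.ofPred E) (t := Set.ofPred F) h hq v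

lemma pr_true (q : (∀ i, 𝔛 i) → ℝ) {E : (∀ i, 𝔛 i) → Prop} (h : ∀ v, E v) :
    pr q E = ∑ v, q v :=
  sum_congr rfl fun v _ => Set.indicator_of_mem (s := Set.ofPred E) (h v) q

lemma pr_eq_apply (q : (∀ i, 𝔛 i) → ℝ) {E : (∀ i, 𝔛 i) → Prop} (w : ∀ i, 𝔛 i)
    (h : ∀ v, E v ↔ v = w) : pr q E = q w := by
  rw [pr_eq_sum_indicator, Fintype.sum_eq_single w fun v hv =>
    Set.indicator_of_notMem (s := Set.ofPred E) (fun hE => hv ((h v).1 hE)) q]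
  exact Set.indicator_of_mem (s := Set.ofPred E) ((h w).2 rfl) q

/-- Marginalization over the coordinate `k`. -/
lemma pr_eq_sum (q : (∀ i, 𝔛 i) → ℝ) (E : (∀ i, 𝔛 i) → Prop) (k : V) :
    pr q E = ∑ x : 𝔛 k, pr q (fun v => v k = x ∧ E v) := by
  simp only [pr_eq_sum_indicator]
  rw [sum_comm]
  refine sum_congr rfl fun v _ => ?_
  rw [Fintype.sum_eq_single (v k) fun x hx =>
    Set.indicator_of_notMem (fun h => hx h.1.symm) q]
  by_cases h : E v
  · rw [Set.indicator_of_mem (show v ∈ Set.ofPred E from h),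
      Set.indicator_of_mem (show v ∈ Set.ofPred fun u => u k = v k ∧ E u from ⟨rfl, h⟩)]
  · rw [Set.indicator_of_notMem (show v ∉ Set.ofPred E from h),
      Set.indicator_of_notMem fun h' => h h'.2]

lemma cpr_mul_pr {q : (∀ i, 𝔛 i) → ℝ} (E : (∀ i, 𝔛 i) → Prop) {F : (∀ i, 𝔛 i) → Prop}
    (h : 0 < pr q F) : cpr q E F * pr q F = pr q (fun v => E v ∧ F v) :=
  div_mul_cancel₀ _ h.ne'

lemma notMem_pre (k : V) : k ∉ pre k := by simp [pre]

/-- Fixing coordinate `k` in addition to its predecessors. -/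
lemma agree_insert_pre (k : V) (w v : ∀ i, 𝔛 i) :
    agree (insert k (pre k)) w v ↔ v k = w k ∧ agree (pre k) w v := by
  simp [agree]

lemma agree_insert_pre_update (k : V) (w v : ∀ i, 𝔛 i) (x : 𝔛 k) :
    agree (insert k (pre k)) (Function.update w k x) v ↔ v k = x ∧ agree (pre k) w v := by
  rw [agree_insert_pre, Function.update_self]
  refine and_congr_right fun _ => forall₂_congr fun j hj => ?_
  rw [Function.update_of_ne (ne_of_mem_of_not_mem hj (notMem_pre k))]

lemma suppIn_setOn {C A : Finset V} (h : C ⊆ A) (c : ∀ i, 𝔛 i) : suppIn (setOn C c) A := by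
  intro i hi
  by_contra hiA
  exact hi (if_neg fun hC => hiA (h hC))

lemma setOn_insert (C : Finset V) (c : ∀ i, 𝔛 i) (i : V) :
    setOn (insert i C) c = Function.update (setOn C c) i (some (c i)) := by
  funext j
  by_cases hj : j = i
  · subst hj; simp [setOn]
  · simp [setOn, hj]

lemma setOn_congr {C : Finset V} {c c' : ∀ i, 𝔛 i} (h : ∀ i ∈ C, c i = c' i) :
    setOn C c = setOn C c' := by
  funext j
  by_cases hj : j ∈ C
  · simp [setOn, hj, h j hj]
  · simp [setOn, hj]

/-- Consistency for joint interventions: setting variables to the values they take anyway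
does not change the probability of a joint assignment. -/
lemma DistConsistent.apply_setOn {A : Finset V} {P : (∀ i, Option (𝔛 i)) → (∀ i, 𝔛 i) → ℝ}
    (hDC : DistConsistent A P) (v : ∀ i, 𝔛 i) {C : Finset V} (hC : C ⊆ A) :
    P (setOn C v) v = P (fun _ => none) v := by
  induction C using Finset.induction_on with
  | empty => rfl
  | insert i C hi ih =>
    have hCA : C ⊆ A \ {i} := fun j hj =>
      mem_sdiff.2 ⟨hC (mem_insert_of_mem hj), by
        simpa using ne_of_mem_of_not_mem hj hi⟩
    have hpt : ∀ u, (agree (univ \ {i}) v u ∧ u i = v i) ↔ u = v := by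
      refine fun u => ⟨fun h => funext fun j => ?_, fun h => by simp [h, agree]⟩
      by_cases hj : j = i
      · rw [hj]; exact h.2
      · exact h.1 j (by simpa using hj)
    have h := hDC i (hC (mem_insert_self i C)) C hCA v (v i) v
    rw [pr_eq_apply _ v hpt, pr_eq_apply _ v hpt] at h
    rw [setOn_insert, h, ih fun j hj => hC (mem_insert_of_mem hj)]

lemma eq_pre_of_isLowerSet_insert {k : V} {S : Finset V} (hS : ∀ j ∈ S, j < k)
    (h : IsLowerSet ((insert k S : Finset V) : Set V)) : S = pre k := by
  ext j
  refine ⟨fun hj => by simpa [pre] using hS j hj, fun hj => ?_⟩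
  have hjk : j < k := by simpa [pre] using hj
  have hmem : j ∈ insert k S := h hjk.le (mem_insert_self k S)
  exact (mem_insert.1 hmem).resolve_left hjk.ne

lemma isLowerSet_pre (k : V) : IsLowerSet ((pre k : Finset V) : Set V) := by
  intro a b hba ha
  simp only [pre, coe_filter, mem_univ, true_and, Set.mem_ofPred_eq] at ha ⊢
  exact hba.trans_lt ha

section

variable {A : Finset V} {P : (∀ i, Option (𝔛 i)) → (∀ i, 𝔛 i) → ℝ}

lemma SWIGLocalMarkov.pr_insert_pre_eq (hP : ∀ f, suppIn f A → IsProb (P f))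
    (hM : SWIGLocalMarkov A (fun i => pre i) P) (k : V) {a a' : ∀ j, 𝔛 j} (w : ∀ j, 𝔛 j)
    (h : ∀ j ∈ pre k ∩ A, a j = a' j)
    (hpre : pr (P (setOn A a)) (agree (pre k) w) = pr (P (setOn A a')) (agree (pre k) w)) :
    pr (P (setOn A a)) (agree (insert k (pre k)) w)
      = pr (P (setOn A a')) (agree (insert k (pre k)) w) := by
  have nn := fun c => (hP _ (suppIn_setOn Subset.rfl c)).1
  rw [pr_congr _ (agree_insert_pre k w), pr_congr _ (agree_insert_pre k w)]
  rcases (pr_nonneg (nn a) (agree (pre k) w)).eq_or_lt with h0 | hpos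
  · have hz : ∀ c, pr (P (setOn A c)) (agree (pre k) w) = 0 →
        pr (P (setOn A c)) (fun v => v k = w k ∧ agree (pre k) w v) = 0 := fun c hc =>
      le_antisymm (hc ▸ pr_mono (nn c) fun v hv => hv.2) (pr_nonneg (nn c) _)
    rw [hz a h0.symm, hz a' (hpre ▸ h0.symm)]
  · have hpos' := hpre ▸ hpos
    rw [← cpr_mul_pr _ hpos, ← cpr_mul_pr _ hpos', hpre,
      hM k a a' w w (w k) hpos hpos' h fun _ _ => rfl]

/-- Interventions do not affect the joint distribution of the variables preceding them. -/
lemma SWIGLocalMarkov.pr_lower_eq (hP : ∀ f, suppIn f A → IsProb (P f))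
    (hM : SWIGLocalMarkov A (fun i => pre i) P) (S : Finset V)
    (hS : IsLowerSet (S : Set V)) {a a' : ∀ j, 𝔛 j} (w : ∀ j, 𝔛 j)
    (h : ∀ j ∈ S ∩ A, a j = a' j) :
    pr (P (setOn A a)) (agree S w) = pr (P (setOn A a')) (agree S w) := by
  induction S using Finset.induction_on_max with
  | empty =>
    rw [pr_true _ (by simp [agree]), pr_true _ (by simp [agree]),
      (hP _ (suppIn_setOn Subset.rfl a)).2, (hP _ (suppIn_setOn Subset.rfl a')).2]
  | insert k S hk ih =>
    obtain rfl := eq_pre_of_isLowerSet_insert hk hS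
    have h' : ∀ j ∈ pre k ∩ A, a j = a' j := fun j hj =>
      h j (inter_subset_inter_right (subset_insert _ _) hj)
    exact hM.pr_insert_pre_eq hP k w h' (ih (isLowerSet_pre k) h')

/-- An initial segment takes given values equally likely in the observed regime and in the
regime that sets the targets to those values. -/
lemma SWIGLocalMarkov.pr_compl_upper_eq (hP : ∀ f, suppIn f A → IsProb (P f))
    (hDC : DistConsistent A P) (hM : SWIGLocalMarkov A (fun i => pre i) P) (U : Finset V)
    (hU : IsUpperSet (U : Set V)) (w : ∀ j, 𝔛 j) :
    pr (P (setOn A w)) (agree Uᶜ w) = pr (P (fun _ => none)) (agree Uᶜ w) := by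
  induction U using Finset.induction_on_min generalizing w with
  | empty =>
    have hpt : ∀ v, agree (∅ : Finset V)ᶜ w v ↔ v = w := by
      simp [agree, funext_iff]
    rw [pr_eq_apply _ w hpt, pr_eq_apply _ w hpt, hDC.apply_setOn w Subset.rfl]
  | insert k T hk ih =>
    have hT : ∀ j, j ∈ T ↔ k < j := fun j => by
      refine ⟨hk j, fun hj => ?_⟩
      have hmem : j ∈ insert k T := hU hj.le (mem_insert_self k T)
      exact (mem_insert.1 hmem).resolve_left hj.ne'
    have hpre : (insert k T)ᶜ = pre k := by
      ext j; simpa [pre, hT, and_comm] using lt_iff_le_and_ne.symm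
    have hins : Tᶜ = insert k (pre k) := by
      ext j; simp [pre, hT, le_iff_eq_or_lt]
    have hTU : IsUpperSet (T : Set V) := fun a b hab ha =>
      (hT b).2 (((hT a).1 ha).trans_le hab)
    rw [hins] at ih
    rw [hpre, pr_eq_sum _ _ k, pr_eq_sum (P fun _ => none) _ k]
    refine sum_congr rfl fun x _ => ?_
    rw [← pr_congr _ (agree_insert_pre_update k w · x),
      ← pr_congr _ (agree_insert_pre_update k w · x), ← ih hTU (Function.update w k x)]
    have h : ∀ j ∈ pre k ∩ A, w j = Function.update w k x j := fun j hj =>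
      (Function.update_of_ne
        (ne_of_mem_of_not_mem (mem_of_mem_inter_left hj) (notMem_pre k)) x w).symm
    exact hM.pr_insert_pre_eq hP k _ h (hM.pr_lower_eq hP _ (isLowerSet_pre k) _ h)

lemma SWIGLocalMarkov.pr_lower_eq_obs (hP : ∀ f, suppIn f A → IsProb (P f))
    (hDC : DistConsistent A P) (hM : SWIGLocalMarkov A (fun i => pre i) P) (S : Finset V)
    (hS : IsLowerSet (S : Set V)) (w : ∀ j, 𝔛 j) :
    pr (P (setOn A w)) (agree S w) = pr (P (fun _ => none)) (agree S w) := by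
  simpa using hM.pr_compl_upper_eq hP hDC Sᶜ (by simpa using hS) w

lemma isLowerSet_insert_pre (k : V) :
    IsLowerSet ((insert k (pre k) : Finset V) : Set V) := by
  intro a b hba ha
  have ha' : a ≤ k := by simpa [pre, le_iff_eq_or_lt] using ha
  simpa [pre, le_iff_eq_or_lt] using hba.trans ha'

/-- The interventional conditionals are the observed ones, evaluated at the intervened values
on the targets. -/
lemma SWIGLocalMarkov.cpr_eq_obs (hP : ∀ f, suppIn f A → IsProb (P f))
    (hDC : DistConsistent A P) (hM : SWIGLocalMarkov A (fun i => pre i) P)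
    (i : V) (a w : ∀ j, 𝔛 j) (x : 𝔛 i)
    (hw : 0 < pr (P (setOn A a)) (agree (pre i) w))
    (hobs : 0 < pr (P (fun _ => none)) (agree (pre i) (A.piecewise a w))) :
    cpr (P (setOn A a)) (fun v => v i = x) (agree (pre i) w)
      = cpr (P (fun _ => none)) (fun v => v i = x) (agree (pre i) (A.piecewise a w)) := by
  set u := A.piecewise a w with hu
  have hset : setOn A a = setOn A u :=
    setOn_congr fun j hj => (piecewise_eq_of_mem A a w hj).symm
  have hpre := hM.pr_lower_eq_obs hP hDC (pre i) (isLowerSet_pre i) u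
  rw [hM i a a w u x hw (by rwa [hset, hpre]) (fun _ _ => rfl) fun j hj =>
    (piecewise_eq_of_notMem A a w (mem_sdiff.1 hj).2).symm, hset, cpr, cpr, hpre,
    ← pr_congr _ (agree_insert_pre_update i u · x), ← pr_congr _ (agree_insert_pre_update i u · x),
    ← hM.pr_lower_eq_obs hP hDC _ (isLowerSet_insert_pre i) (Function.update u i x)]
  have h : ∀ j ∈ pre i ∩ A, u j = Function.update u i x j := fun j hj =>
    (Function.update_of_ne
      (ne_of_mem_of_not_mem (mem_of_mem_inter_left hj) (notMem_pre i)) x u).symm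
  rw [hM.pr_insert_pre_eq hP i _ h (hM.pr_lower_eq hP _ (isLowerSet_pre i) _ h)]

end

/-- Theorem (two-graph construction): the SWIG local Markov property for the
complete DAG (parents = all predecessors) together with a strictly positive
observed distribution obeying the ordinary local Markov property for a subgraph
`𝒢` implies the SWIG local Markov property for `𝒢`. -/
theorem stmt17_two_graph_swig
    (A : Finset V) (hA : A ⊆ univ)
    (pa : V → Finset V) (hpa : ∀ i, pa i ⊆ pre i)
    (P : (∀ i, Option (𝔛 i)) → (∀ i, 𝔛 i) → ℝ)
    (hP : ∀ f, suppIn f A → IsProb (P f))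
    (hDC : DistConsistent A P)
    (hMbar : SWIGLocalMarkov A (fun i => pre i) P)
    (hpos : ∀ v : (∀ j, 𝔛 j), 0 < P (fun _ => none) v)
    (hObs : OrderedLocalMarkov pa (P (fun _ => none))) :
    SWIGLocalMarkov A pa P := by
  intro i a a' w w' x hw hw' ha hww
  have hobs : ∀ u : (∀ j, 𝔛 j), 0 < pr (P (fun _ => none)) (agree (pre i) u) := fun u => by
    refine (hpos u).trans_le ?_
    rw [← pr_eq_apply (P fun _ => none) (E := fun v => v = u) u fun _ => Iff.rfl]
    exact pr_mono (fun v => (hpos v).le) (by rintro v rfl j _; rfl)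
  rw [hMbar.cpr_eq_obs hP hDC i a w x hw (hobs _),
    hMbar.cpr_eq_obs hP hDC i a' w' x hw' (hobs _)]
  refine hObs i _ _ x (hobs _) (hobs _) fun j hj => ?_
  by_cases hjA : j ∈ A
  · simpa [hjA] using ha j (mem_inter.2 ⟨hj, hjA⟩)
  · simpa [hjA] using hww j (mem_sdiff.2 ⟨hj, hjA⟩)

end CausalPaper
end

section
/- Dawid's intersection-type implication for extended conditional independence fails without variation independence of the non-stochastic variables: let 𝔖 = {-2,-1}² ∪ {1,2}² ⊆ ℤ². There exists a family of probability distributions q(X = x, Y = y | a, b) on Bool × Bool indexed by (a,b) ∈ 𝔖 such that (i) for every b and every x, the conditional probability q(Y = y | X = x, a, b) takes the same value for all a with (a,b) ∈ 𝔖 for which it is well-defined (the extended conditional independence Y ⫫ A | B, X); (ii) symmetrically, for every a and every x, q(Y = y | X = x, a, b) takes the same value for all b with (a,b) ∈ 𝔖 for which it is well-defined (Y ⫫ B | A, X); but (iii) there exist (a,b), (a′,b′) ∈ 𝔖, x and y such that both conditional probabilities q(Y = y | X = x, a, b) and q(Y = y | X = x, a′, b′) are well-defined and unequal, so that Y ⫫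 (A,B) | X fails. -/
open Finset

namespace CausalPaper

/-- The non-product index set 𝔖 = {-2,-1}² ∪ {1,2}² of values for the
non-stochastic variables (A, B): they are not variation independent. -/
def SS : Set (ℤ × ℤ) :=
  {p | ((p.1 = -2 ∨ p.1 = -1) ∧ (p.2 = -2 ∨ p.2 = -1)) ∨
       ((p.1 = 1 ∨ p.1 = 2) ∧ (p.2 = 1 ∨ p.2 = 2))}

/-- Dawid's intersection-type implication for extended conditional independence fails
without variation independence: there is a kernel `q(x, y | a, b)` indexed by
`(a, b) ∈ 𝔖` satisfying `Y ⫫ A | B, X` and `Y ⫫ B | A, X` but not `Y ⫫ (A, B) | X`. -/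
theorem stmt19_intersection_counterexample :
    ∃ q : ℤ → ℤ → Bool → Bool → ℝ,
      (∀ a b : ℤ, (a, b) ∈ SS →
        ((∀ x y : Bool, 0 ≤ q a b x y) ∧ (∑ x : Bool, ∑ y : Bool, q a b x y) = 1)) ∧
      (∀ (b a a' : ℤ) (x y : Bool), (a, b) ∈ SS → (a', b) ∈ SS →
        0 < (∑ y' : Bool, q a b x y') → 0 < (∑ y' : Bool, q a' b x y') →
        q a b x y / (∑ y' : Bool, q a b x y')
          = q a' b x y / (∑ y' : Bool, q a' b x y')) ∧
      (∀ (a b b' : ℤ) (x y : Bool), (a, b) ∈ SS → (a, b') ∈ SS →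
        0 < (∑ y' : Bool, q a b x y') → 0 < (∑ y' : Bool, q a b' x y') →
        q a b x y / (∑ y' : Bool, q a b x y')
          = q a b' x y / (∑ y' : Bool, q a b' x y')) ∧
      (∃ (a b a' b' : ℤ) (x y : Bool), (a, b) ∈ SS ∧ (a', b') ∈ SS ∧
        0 < (∑ y' : Bool, q a b x y') ∧ 0 < (∑ y' : Bool, q a' b' x y') ∧
        q a b x y / (∑ y' : Bool, q a b x y')
          ≠ q a' b' x y / (∑ y' : Bool, q a' b' x y')) := by
  have same_a : ∀ {a a' b : ℤ}, (a, b) ∈ SS → (a', b) ∈ SS → (0 < a ↔ 0 < a') := by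
    intro a a' b h h'
    simp only [SS, Set.mem_ofPred_eq] at h h'
    omega
  refine ⟨fun a _ _ y => if (0 < a ↔ y = true) then 1 / 2 else 0, ?_, ?_, ?_, ?_⟩
  · intro a b _
    refine ⟨fun x y => by positivity, ?_⟩
    by_cases h : 0 < a <;> norm_num [h]
  · intro b a a' x y h h' _ _
    simp only [same_a h h']
  · intros
    rfl
  · refine ⟨1, 1, -1, -1, true, true, ?_, ?_, ?_, ?_, ?_⟩ <;> norm_num [SS]

end CausalPaper
end
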